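/- Fix positive reals n_A > n_B, k_A, k_B > 0, and N λ_b > 0. Consider the equation (n_A − n_B w)/(k_B + k_A w) = (N λ_b/(k_A + k_B)) · log w in the unknown w. This equation has a unique solution w* and it satisfies 1 ≤ w* ≤ n_A/n_B. -/

import Mathlib

theorem bias_equation_unique_solution
    (nA nB kA kB N lamb : ℝ)
    (hnB : 0 < nB) (hAB : nB < nA) (hkA : 0 < kA) (hkB : 0 < kB)
    (hN : 0 < N) (hlamb : 0 < lamb) :
    (∃! w : ℝ, 0 < w ∧
      (nA - nB * w) / (kB + kA * w) = (N * lamb / (kA + kB)) * Real.log w) ∧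
    (∀ w : ℝ, 0 < w →
      (nA - nB * w) / (kB + kA * w) = (N * lamb / (kA + kB)) * Real.log w →
      1 ≤ w ∧ w ≤ nA / nB) := by
  have hc : 0 < N * lamb / (kA + kB) := by positivity
  generalize N * lamb / (kA + kB) = c at hc ⊢
  have hnA : 0 < nA := hnB.trans hAB
  have h1 : 1 < nA / nB := by rw [lt_div_iff₀ hnB]; linarith
  have key : ∀ x y : ℝ, 0 < x → x < y →
      (nA - nB * x) / (kB + kA * x) = c * Real.log x →
      (nA - nB * y) / (kB + kA * y) = c * Real.log y → False := by
    intro x y hx hxy ex ey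
    have hy : 0 < y := hx.trans hxy
    have hl : c * Real.log x < c * Real.log y :=
      mul_lt_mul_of_pos_left (Real.log_lt_log hx hxy) hc
    have hd : (nA - nB * y) / (kB + kA * y) < (nA - nB * x) / (kB + kA * x) := by
      rw [div_lt_div_iff₀ (by positivity) (by positivity)]
      have h2 : 0 < (nA * kA + nB * kB) * (y - x) :=
        mul_pos (by positivity) (by linarith)
      nlinarith
    linarith
  refine ⟨?_, ?_⟩
  · have hcont : ContinuousOn
        (fun w : ℝ => c * Real.log w - (nA - nB * w) / (kB + kA * w))
        (Set.Icc 1 (nA / nB)) := by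
      apply ContinuousOn.sub
      · apply ContinuousOn.mul continuousOn_const
        apply Real.continuousOn_log.mono
        intro w hw
        have : (0:ℝ) < w := lt_of_lt_of_le one_pos hw.1
        exact this.ne'
      · apply ContinuousOn.div (by fun_prop) (by fun_prop)
        intro w hw
        have : (0:ℝ) < w := lt_of_lt_of_le one_pos hw.1
        positivity
    have h0 : (0:ℝ) ∈ Set.Icc
        ((fun w : ℝ => c * Real.log w - (nA - nB * w) / (kB + kA * w)) 1)
        ((fun w : ℝ => c * Real.log w - (nA - nB * w) / (kB + kA * w)) (nA / nB)) := by
      constructor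
      · have : 0 < (nA - nB * 1) / (kB + kA * 1) :=
          div_pos (by linarith) (by positivity)
        simp only [Real.log_one]
        linarith
      · have e : nA - nB * (nA / nB) = 0 := by field_simp; ring
        have := mul_pos hc (Real.log_pos h1)
        simp only [e, zero_div]
        linarith
    obtain ⟨w, hw, hw0⟩ := intermediate_value_Icc h1.le hcont h0
    have hwp : (0:ℝ) < w := lt_of_lt_of_le one_pos hw.1
    have hwe : (nA - nB * w) / (kB + kA * w) = c * Real.log w := by
      simp only at hw0
      linarith
    refine ⟨w, ⟨hwp, hwe⟩, ?_⟩
    rintro y ⟨hy, hye⟩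
    rcases lt_trichotomy y w with h | h | h
    · exact (key y w hy h hye hwe).elim
    · exact h
    · exact (key w y hwp h hwe hye).elim
  · intro w hw he
    have hden : 0 < kB + kA * w := by positivity
    constructor
    · by_contra! h
      have a : 0 < (nA - nB * w) / (kB + kA * w) := div_pos (by nlinarith) hden
      have b := mul_neg_of_pos_of_neg hc (Real.log_neg hw h)
      linarith
    · by_contra! h
      have h' := h
      rw [div_lt_iff₀ hnB] at h'
      have a : (nA - nB * w) / (kB + kA * w) < 0 :=
        div_neg_of_neg_of_pos (by linarith) hden
      have b := mul_pos hc (Real.log_pos (h1.trans h))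
      linarith
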